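/- Let 0<q<1 be real, h'1,h'2,l'1,l'2,α'1,α'2,β',μ0,α1 real, t1,t2,ξ nonzero complex numbers, and E',C1,C2 ∈ ℂ. Set λ = (h'1+h'2−l'1−l'2−α'1−α'2+β'+2)/2, χ = (l'1+l'2−h'1−h'2−α'1+α'2−β')/2, μ = μ0+1+χ, E = q^{μ0+α1−α'1}E', β = −β'−χ, α2 = α1−α'1+α'2−χ, l_i = l'_i+μ0 and h_i = h'_i+μ0+χ for i=1,2. Assume h satisfies (A⟨4⟩(s; h'1,h'2,l'1,l'2,α'1,α'2,β')h)(s) = E'·h(s) for all s ∈ {q^{n}ξ : n∈ℤ}, that h(q^{L}ξ)/(q^{L}ξ)^{λ} → C1 as the integer L → +∞, and that h(q^{K}ξ)/(q^{K}ξ)^{−α'1} → C2 as the integer K → −∞. Then for every nonzero complex x with x ∉ {q^{μ0+n}ξ : n∈ℤ}, the Jackson integral g(x) = x^{−α1}·∫₀^{ξ∞} s^{−λ}·h(s)·P¹_{μ,μ0}(x,s) d_q s converges, and (A⟨4⟩(x; h1,h2,l1,l2,α1,α2,β)g)(x) = E·g(x) + (1−q)·(g2(x) − g1(x)), where g1(x)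 = C1·x^{−α1}·q^{μ0+α1+h'1+h'2+χ}·(q^{β'}−1)·t1t2 and g2(x) = C2·x^{−α1}·(θ_q(q^{−μ0−χ}x/ξ)/θ_q(q^{−μ0+1}x/ξ))·ξ^{χ+1}·q^{μ0+α1}·(q^{α'2−α'1}−1). In particular, if C1 = C2 = 0 then (A⟨4⟩(x; h1,h2,l1,l2,α1,α2,β)g)(x) = E·g(x). -/

import Mathlib

open Filter Topology

/-- The infinite q-Pochhammer symbol `(a;q)_∞ = ∏_{j=0}^∞ (1 - q^j a)`. -/
noncomputable def qPochInf (q : ℝ) (a : ℂ) : ℂ := ∏' j : ℕ, (1 - (q : ℂ) ^ j * a)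

/-- `q^r` for a real exponent `r`, using the principal branch of the complex power. -/
noncomputable def qpow (q : ℝ) (r : ℝ) : ℂ := (q : ℂ) ^ (r : ℂ)

/-- The fourth degenerate Ruijsenaars–van Diejen operator `A⟨4⟩` applied to `g` at `x`. -/
noncomputable def A4 (q : ℝ) (t1 t2 : ℂ) (h1 h2 l1 l2 a1 a2 b : ℝ) (g : ℂ → ℂ) (x : ℂ) : ℂ :=
  x⁻¹ * (x - qpow q (h1 + 1/2) * t1) * (x - qpow q (h2 + 1/2) * t2) * g (x / (q : ℂ))
    + qpow q (a1 + a2) * x⁻¹ * (x - qpow q (l1 - 1/2) * t1) * (x - qpow q (l2 - 1/2) * t2) *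
        g ((q : ℂ) * x)
    - ((qpow q a1 + qpow q a2) * x
        + qpow q ((h1 + h2 + l1 + l2 + a1 + a2) / 2) * (qpow q (b / 2) + qpow q (-(b / 2))) *
            t1 * t2 * x⁻¹) * g x

/-- `P¹_{μ,μ0}(x,s) = (q^μ s/x;q)_∞ / (q^{μ0} s/x;q)_∞`. -/
noncomputable def P1 (q μ μ0 : ℝ) (x s : ℂ) : ℂ :=
  qPochInf q (qpow q μ * s / x) / qPochInf q (qpow q μ0 * s / x)

/-- The theta function `θ_q(t) = (t;q)_∞ (q/t;q)_∞ (q;q)_∞`. -/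
noncomputable def thetaQ (q : ℝ) (t : ℂ) : ℂ :=
  qPochInf q t * qPochInf q ((q : ℂ) / t) * qPochInf q (q : ℂ)

/-- The bilateral series `Σ_{n∈ℤ} f n` converges to `S`: the series over `n ≥ 0` and the
series over `n < 0` both converge, with sum `S`. -/
def HasBilatSum (f : ℤ → ℂ) (S : ℂ) : Prop :=
  ∃ Sp Sm : ℂ,
    Filter.Tendsto (fun N : ℕ => ∑ n ∈ Finset.range N, f n) Filter.atTop (nhds Sp) ∧
    Filter.Tendsto (fun N : ℕ => ∑ n ∈ Finset.range N, f (-(n : ℤ) - 1)) Filter.atTop (nhds Sm) ∧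
    S = Sp + Sm

lemma qpow_add {q : ℝ} (hq : 0 < q) (r s : ℝ) : qpow q (r + s) = qpow q r * qpow q s := by
  simp only [qpow, Complex.ofReal_add]
  exact Complex.cpow_add _ _ (by exact_mod_cast hq.ne')

lemma qpow_neg (q r : ℝ) : qpow q (-r) = (qpow q r)⁻¹ := by
  simp only [qpow, Complex.ofReal_neg, Complex.cpow_neg]

lemma qpow_sub {q : ℝ} (hq : 0 < q) (r s : ℝ) : qpow q (r - s) = qpow q r / qpow q s := by
  rw [sub_eq_add_neg, qpow_add hq, qpow_neg, div_eq_mul_inv]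

lemma qpow_one (q : ℝ) : qpow q 1 = q := by
  simp [qpow]

lemma qpow_intCast (q : ℝ) (n : ℤ) : qpow q n = (q : ℂ) ^ n := by
  simp [qpow]

lemma qpow_ne_zero {q : ℝ} (hq : 0 < q) (r : ℝ) : qpow q r ≠ 0 := by
  simp [qpow, Complex.cpow_eq_zero_iff, hq.ne']

lemma ofReal_mul_cpow {q : ℝ} (hq : 0 < q) {z : ℂ} (hz : z ≠ 0) (r : ℝ) :
    ((q : ℂ) * z) ^ (r : ℂ) = qpow q r * z ^ (r : ℂ) := by
  have hq' : (q : ℂ) ≠ 0 := by exact_mod_cast hq.ne'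
  rw [qpow, Complex.cpow_def_of_ne_zero (mul_ne_zero hq' hz), Complex.cpow_def_of_ne_zero hq',
    Complex.cpow_def_of_ne_zero hz, Complex.log_ofReal_mul hq hz, ← Complex.exp_add,
    Complex.ofReal_log hq.le]
  ring_nf

lemma div_ofReal_cpow {q : ℝ} (hq : 0 < q) {z : ℂ} (hz : z ≠ 0) (r : ℝ) :
    (z / (q : ℂ)) ^ (r : ℂ) = (qpow q r)⁻¹ * z ^ (r : ℂ) := by
  have hq' : (q : ℂ) ≠ 0 := by exact_mod_cast hq.ne'
  have := ofReal_mul_cpow hq (div_ne_zero hz hq') r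
  rw [mul_div_cancel₀ _ hq'] at this
  rw [this, inv_mul_cancel_left₀ (qpow_ne_zero hq r)]

section QPochhammer

variable {q : ℝ}

lemma summable_norm_qPoch (hq0 : 0 < q) (hq1 : q < 1) (a : ℂ) :
    Summable fun j : ℕ => ‖-((q : ℂ) ^ j * a)‖ := by
  have : Summable fun j : ℕ => q ^ j * ‖a‖ :=
    (summable_geometric_of_lt_one hq0.le hq1).mul_right _
  simpa [abs_of_pos hq0] using this

lemma multipliable_qPoch (hq0 : 0 < q) (hq1 : q < 1) (a : ℂ) :
    Multipliable fun j : ℕ => 1 - (q : ℂ) ^ j * a := by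
  simpa only [sub_eq_add_neg] using
    multipliable_one_add_of_summable (summable_norm_qPoch hq0 hq1 a)

lemma qPochInf_ne_zero (hq0 : 0 < q) (hq1 : q < 1) {a : ℂ}
    (ha : ∀ j : ℕ, (q : ℂ) ^ j * a ≠ 1) : qPochInf q a ≠ 0 := by
  have := tprod_one_add_ne_zero_of_summable (f := fun j : ℕ => -((q : ℂ) ^ j * a))
    (fun j => by rw [← sub_eq_add_neg]; exact sub_ne_zero.2 (ha j).symm)
    (summable_norm_qPoch hq0 hq1 a)
  simpa only [qPochInf, sub_eq_add_neg] using this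

lemma qPochInf_eq (hq0 : 0 < q) (hq1 : q < 1) (a : ℂ) :
    qPochInf q a = (1 - a) * qPochInf q (q * a) := by
  have hshift : (fun j : ℕ => 1 - (q : ℂ) ^ (j + 1) * a) = fun j => 1 - (q : ℂ) ^ j * (q * a) := by
    funext j; ring
  rw [qPochInf, tprod_eq_zero_mul' (by rw [hshift]; exact multipliable_qPoch hq0 hq1 _), hshift]
  simp [qPochInf]

lemma tendsto_prod_qPochInf (hq0 : 0 < q) (hq1 : q < 1) (a : ℂ) :
    Tendsto (fun N : ℕ => ∏ j ∈ Finset.range N, (1 - (q : ℂ) ^ j * a)) atTop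
      (𝓝 (qPochInf q a)) :=
  (multipliable_qPoch hq0 hq1 a).tendsto_prod_tprod_nat

lemma prod_mul_qPochInf (hq0 : 0 < q) (hq1 : q < 1) (a : ℂ) (N : ℕ) :
    qPochInf q a = (∏ j ∈ Finset.range N, (1 - (q : ℂ) ^ j * a)) * qPochInf q (q ^ N * a) := by
  induction N with
  | zero => simp
  | succ N ih =>
    rw [ih, Finset.prod_range_succ, qPochInf_eq hq0 hq1 (q ^ N * a), pow_succ']
    ring_nf

lemma tendsto_pow_mul_zero (hq0 : 0 < q) (hq1 : q < 1) (a : ℂ) :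
    Tendsto (fun N : ℕ => (q : ℂ) ^ N * a) atTop (𝓝 0) := by
  simpa using (tendsto_pow_atTop_nhds_zero_of_norm_lt_one
    (x := (q : ℂ)) (by simpa [abs_of_pos hq0] using hq1)).mul_const a

lemma tendsto_qPochInf_pow_mul (hq0 : 0 < q) (hq1 : q < 1) (a : ℂ) :
    Tendsto (fun N : ℕ => qPochInf q (q ^ N * a)) atTop (𝓝 1) := by
  obtain ⟨M, hM⟩ : ∃ M : ℕ, ∀ j ≥ M, (q : ℂ) ^ j * a ≠ 1 := by
    have := (tendsto_pow_mul_zero hq0 hq1 a).eventually_ne (zero_ne_one (α := ℂ))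
    exact eventually_atTop.1 this
  have hne : qPochInf q (q ^ M * a) ≠ 0 := by
    refine qPochInf_ne_zero hq0 hq1 fun j => ?_
    rw [← mul_assoc, ← pow_add]
    exact hM _ (by omega)
  rw [← tendsto_add_atTop_iff_nat M]
  have hlim := (tendsto_const_nhds (x := qPochInf q (q ^ M * a))).div
    (tendsto_prod_qPochInf hq0 hq1 (q ^ M * a)) hne
  rw [div_self hne] at hlim
  refine hlim.congr fun N => ?_
  have h := prod_mul_qPochInf hq0 hq1 (q ^ M * a) N
  have hprod : (∏ j ∈ Finset.range N, (1 - (q : ℂ) ^ j * (q ^ M * a))) ≠ 0 := by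
    intro h0; rw [h0, zero_mul] at h; exact hne h
  rw [pow_add, mul_assoc]
  nth_rewrite 1 [h]
  exact mul_div_cancel_left₀ _ hprod

lemma qPochInf_zpow_neg (hq0 : 0 < q) (hq1 : q < 1) {c : ℂ} (hc : c ≠ 0) (N : ℕ) :
    qPochInf q ((q : ℂ) ^ (-(N : ℤ)) * c) = qPochInf q c *
      ∏ j ∈ Finset.range N, (-c * ((q : ℂ) ^ (j + 1))⁻¹ * (1 - (q : ℂ) ^ j * (q / c))) := by
  have hq' : (q : ℂ) ≠ 0 := by exact_mod_cast hq0.ne'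
  induction N with
  | zero => simp
  | succ N ih =>
    rw [Finset.prod_range_succ, ← mul_assoc, ← ih, qPochInf_eq hq0 hq1]
    have e : (q : ℂ) * ((q : ℂ) ^ (-((N + 1 : ℕ) : ℤ)) * c) = (q : ℂ) ^ (-(N : ℤ)) * c := by
      rw [← mul_assoc, ← zpow_one_add₀ hq']
      congr 2; push_cast; ring
    rw [e, mul_comm, zpow_neg, zpow_natCast, zpow_neg, zpow_natCast]
    congr 1
    field_simp
    ring

lemma qPochInf_div_zpow_neg (hq0 : 0 < q) (hq1 : q < 1) {c d : ℂ} (hc : c ≠ 0) (hd : d ≠ 0)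
    (N : ℕ) :
    qPochInf q ((q : ℂ) ^ (-(N : ℤ)) * c) / qPochInf q ((q : ℂ) ^ (-(N : ℤ)) * d) *
      (d / c) ^ N = qPochInf q c * (∏ j ∈ Finset.range N, (1 - (q : ℂ) ^ j * (q / c))) /
        (qPochInf q d * ∏ j ∈ Finset.range N, (1 - (q : ℂ) ^ j * (q / d))) := by
  have hq' : (q : ℂ) ≠ 0 := by exact_mod_cast hq0.ne'
  have hr : ∏ j ∈ Finset.range N, ((q : ℂ) ^ (j + 1))⁻¹ ≠ 0 :=
    Finset.prod_ne_zero_iff.2 fun j _ => inv_ne_zero (pow_ne_zero _ hq')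
  rw [qPochInf_zpow_neg hq0 hq1 hc, qPochInf_zpow_neg hq0 hq1 hd]
  simp only [Finset.prod_mul_distrib, Finset.prod_const, Finset.card_range, neg_pow c, neg_pow d]
  have h1 : (-1 : ℂ) ^ N ≠ 0 := pow_ne_zero _ (by norm_num)
  rw [div_pow]
  have hcN := pow_ne_zero N hc
  have hdN := pow_ne_zero N hd
  generalize ∏ j ∈ Finset.range N, ((q : ℂ) ^ (j + 1))⁻¹ = R at hr
  generalize ∏ j ∈ Finset.range N, (1 - (q : ℂ) ^ j * (q / c)) = Rc
  generalize ∏ j ∈ Finset.range N, (1 - (q : ℂ) ^ j * (q / d)) = Rd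
  field_simp

/-- Behaviour at infinity along a `q`-spiral of a ratio of two infinite `q`-Pochhammer symbols. -/
lemma tendsto_qPochInf_div_zpow_neg (hq0 : 0 < q) (hq1 : q < 1) {c d : ℂ} (hc : c ≠ 0)
    (hd : ∀ n : ℤ, (q : ℂ) ^ n * d ≠ 1) (hd0 : d ≠ 0) :
    Tendsto (fun N : ℕ => qPochInf q ((q : ℂ) ^ (-(N : ℤ)) * c) /
      qPochInf q ((q : ℂ) ^ (-(N : ℤ)) * d) * (d / c) ^ N) atTop
      (𝓝 (thetaQ q (q / c) / thetaQ q (q / d))) := by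
  have hq' : (q : ℂ) ≠ 0 := by exact_mod_cast hq0.ne'
  have hd1 : qPochInf q d ≠ 0 := qPochInf_ne_zero hq0 hq1 fun j => by
    simpa using hd j
  have hd2 : qPochInf q (q / d) ≠ 0 := qPochInf_ne_zero hq0 hq1 fun j h => by
    apply hd (-(j + 1 : ℕ))
    rw [zpow_neg, zpow_natCast, pow_succ]
    field_simp
    field_simp at h
    rw [← h]
  have hqq : qPochInf q (q : ℂ) ≠ 0 := qPochInf_ne_zero hq0 hq1 fun j h => by
    rw [← pow_succ] at h
    have h' : q ^ (j + 1) = 1 := by exact_mod_cast h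
    exact (pow_lt_one₀ hq0.le hq1 (Nat.succ_ne_zero j)).ne h'
  have hlim := ((tendsto_prod_qPochInf hq0 hq1 (q / c)).const_mul (qPochInf q c)).div
    ((tendsto_prod_qPochInf hq0 hq1 (q / d)).const_mul (qPochInf q d)) (mul_ne_zero hd1 hd2)
  have e : thetaQ q (q / c) / thetaQ q (q / d) =
      qPochInf q c * qPochInf q (q / c) / (qPochInf q d * qPochInf q (q / d)) := by
    simp only [thetaQ, div_div_cancel₀ hq']
    field_simp
  rw [e]
  exact hlim.congr fun N => (qPochInf_div_zpow_neg hq0 hq1 hc hd0 N).symm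

end QPochhammer

/-- A convergent sequence times a geometric one is summable. -/
lemma summable_mul_pow {q : ℝ} (hq0 : 0 < q) (hq1 : q < 1) {u : ℕ → ℂ} {a : ℂ}
    (hu : Tendsto u atTop (𝓝 a)) : Summable fun n => u n * (q : ℂ) ^ n := by
  refine summable_of_isBigO_nat (g := fun n : ℕ => q ^ n)
    (summable_geometric_of_lt_one hq0.le hq1) ?_
  have h1 : u =O[atTop] (fun _ => (1 : ℝ)) := hu.isBigO_one ℝ
  have h2 : (fun n : ℕ => (q : ℂ) ^ n) =O[atTop] (fun n : ℕ => q ^ n) :=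
    Asymptotics.isBigO_of_le _ fun n => by simp
  simpa using h1.mul h2

lemma HasBilatSum.tendsto {f : ℤ → ℂ} {S : ℂ} (hf : HasBilatSum f S) :
    Tendsto (fun N : ℕ => ∑ n ∈ Finset.range N, (f n + f (-(n : ℤ) - 1))) atTop (𝓝 S) := by
  obtain ⟨Sp, Sm, hp, hm, rfl⟩ := hf
  simpa only [Finset.sum_add_distrib] using hp.add hm

lemma sum_bilat_telescope (G : ℤ → ℂ) (N : ℕ) :
    ∑ n ∈ Finset.range N, ((G (n + 1) - G n) + (G (-(n : ℤ) - 1 + 1) - G (-(n : ℤ) - 1))) =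
      G N - G (-(N : ℤ)) := by
  induction N with
  | zero => simp
  | succ N ih =>
    rw [Finset.sum_range_succ, ih]
    push_cast
    rw [show -(N : ℤ) - 1 + 1 = -N by ring, show -((N : ℤ) + 1) = -N - 1 by ring]
    ring

/-- The kernel identity relating the two operators. -/
lemma kernel_identity {q p k A A1 A2 x s : ℂ} (u1 u2 v1 v2 : ℂ) {Pm P0 Pp X : ℂ}
    (hq : q ≠ 0) (hk : k ≠ 0) (hA1 : A1 ≠ 0) (hx : x ≠ 0) (hs : s ≠ 0)
    (hne : 1 - p * s / x / q ≠ 0)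
    (h0 : P0 = (1 - p * q * k * s / x) * X) (hp : Pp = (1 - p * s / x) * X)
    (hm : Pm * (1 - p * s / x / q) = (1 - p * k * s / x) * P0) :
    A * (x⁻¹ * (x - p * k * u1) * (x - p * k * u2)) * Pp
      + A * A2 / (A1 * k) * (x⁻¹ * (x - p * v1) * (x - p * v2)) * Pm
      - ((A + A * A2 / (A1 * k)) * x
        + (q * v1 * v2 * p ^ 2 * A * A2 / A1 + u1 * u2 / q * k * p ^ 2 * A) * x⁻¹) * P0
    = p * A / A1 * (A1 * k * ((q * s)⁻¹ * (q * s - u1) * (q * s - u2)) * Pp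
      + A1 * A2 / (A1 * k) * ((s / q)⁻¹ * (s / q - v1) * (s / q - v2)) * Pm
      - ((A1 + A2) * s + (q * v1 * v2 * A2 / k + u1 * u2 / q * A1 * k) * s⁻¹) * P0) := by
  have hm' : Pm = (1 - p * k * s / x) * P0 / (1 - p * s / x / q) := by
    rw [← hm, mul_div_cancel_right₀ _ hne]
  rw [hm', h0, hp]
  have hne' : x * q - p * s ≠ 0 := by
    intro h; apply hne; field_simp; linear_combination h
  have e : 1 - p * s / x / q = (x * q - p * s) / (x * q) := by field_simp
  rw [e]
  field_simp
  ring

section Kernel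

variable {q : ℝ}

lemma P1_div_q (q : ℝ) (μ μ0 : ℝ) (x s : ℂ) : P1 q μ μ0 (x / q) s = P1 q μ μ0 x (q * s) := by
  simp only [P1, div_div_eq_mul_div]
  congr 2 <;> ring

lemma P1_mul_q (q : ℝ) (μ μ0 : ℝ) (x s : ℂ) : P1 q μ μ0 (q * x) s = P1 q μ μ0 x (s / q) := by
  simp only [P1]
  congr 2 <;> ring

/-- The common factor of `P¹(x,s)` and `P¹(x,qs)`. -/
lemma exists_P1_factor (hq0 : 0 < q) (hq1 : q < 1) (μ μ0 : ℝ) {x s : ℂ}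
    (hne : 1 - qpow q μ0 * s / x ≠ 0) :
    ∃ X : ℂ, P1 q μ μ0 x s = (1 - qpow q μ * s / x) * X ∧
      P1 q μ μ0 x (q * s) = (1 - qpow q μ0 * s / x) * X := by
  refine ⟨qPochInf q (q * (qpow q μ * s / x)) / qPochInf q (qpow q μ0 * s / x), ?_, ?_⟩
  · rw [P1, qPochInf_eq hq0 hq1 (qpow q μ * s / x), mul_div_assoc]
  · rw [P1, qPochInf_eq hq0 hq1 (qpow q μ0 * s / x),
      show qpow q μ * (q * s) / x = q * (qpow q μ * s / x) by ring,
      show qpow q μ0 * (q * s) / x = q * (qpow q μ0 * s / x) by ring]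
    generalize qPochInf q (q * (qpow q μ * s / x)) = U
    generalize qPochInf q (q * (qpow q μ0 * s / x)) = V
    generalize 1 - qpow q μ0 * s / x = w at hne
    field_simp

lemma P1_q_mul (hq0 : 0 < q) (hq1 : q < 1) (μ μ0 : ℝ) {x s : ℂ}
    (hne : 1 - qpow q μ0 * s / x ≠ 0) :
    P1 q μ μ0 x (q * s) * (1 - qpow q μ * s / x) = P1 q μ μ0 x s * (1 - qpow q μ0 * s / x) := by
  obtain ⟨X, h0, h1⟩ := exists_P1_factor hq0 hq1 μ μ0 hne
  rw [h0, h1]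
  ring

lemma one_sub_ne_zero_of_avoids (hq0 : 0 < q) {μ0 : ℝ} {x ξ : ℂ} (hx : x ≠ 0)
    (hav : ∀ n : ℤ, x ≠ qpow q (μ0 + n) * ξ) (n : ℤ) :
    1 - qpow q μ0 * ((q : ℂ) ^ n * ξ) / x ≠ 0 := by
  intro h
  apply hav n
  rw [qpow_add hq0, qpow_intCast]
  field_simp at h
  linear_combination h

lemma avoids_div (hq0 : 0 < q) {μ0 : ℝ} {x ξ : ℂ}
    (hav : ∀ n : ℤ, x ≠ qpow q (μ0 + n) * ξ) (n : ℤ) : x / q ≠ qpow q (μ0 + n) * ξ := by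
  have hq' : (q : ℂ) ≠ 0 := by exact_mod_cast hq0.ne'
  intro h
  apply hav (n + 1)
  rw [div_eq_iff hq'] at h
  rw [h]
  push_cast
  rw [← add_assoc, qpow_add hq0 _ 1, qpow_one]
  ring

lemma avoids_mul (hq0 : 0 < q) {μ0 : ℝ} {x ξ : ℂ}
    (hav : ∀ n : ℤ, x ≠ qpow q (μ0 + n) * ξ) (n : ℤ) : q * x ≠ qpow q (μ0 + n) * ξ := by
  have hq' : (q : ℂ) ≠ 0 := by exact_mod_cast hq0.ne'
  intro h
  apply hav (n - 1)
  push_cast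
  rw [← add_sub_assoc, qpow_sub hq0 _ 1, qpow_one]
  field_simp
  linear_combination h

lemma tendsto_P1_atTop (hq0 : 0 < q) (hq1 : q < 1) (μ μ0 : ℝ) (x ξ : ℂ) :
    Tendsto (fun N : ℕ => P1 q μ μ0 x ((q : ℂ) ^ (N : ℤ) * ξ)) atTop (𝓝 1) := by
  have := (tendsto_qPochInf_pow_mul hq0 hq1 (qpow q μ * ξ / x)).div
    (tendsto_qPochInf_pow_mul hq0 hq1 (qpow q μ0 * ξ / x)) one_ne_zero
  rw [div_one] at this
  refine this.congr fun N => ?_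
  simp only [P1, zpow_natCast, Pi.div_apply]
  congr 2 <;> ring

lemma zpow_mul_cpow (hq0 : 0 < q) {ξ : ℂ} (hξ : ξ ≠ 0) (r : ℝ) (n : ℤ) :
    ((q : ℂ) ^ n * ξ) ^ (r : ℂ) = qpow q r ^ n * ξ ^ (r : ℂ) := by
  have h := ofReal_mul_cpow (q := q ^ n) (zpow_pos hq0 n) hξ r
  push_cast at h
  rw [h, qpow, qpow]
  congr 1
  push_cast
  rw [← Complex.cpow_mul_int, mul_comm, Complex.cpow_int_mul, ← Complex.ofReal_zpow,
    ← Complex.ofReal_cpow (zpow_pos hq0 n).le, ← Complex.ofReal_cpow hq0.le,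
    ← Complex.ofReal_zpow, ← Real.rpow_intCast, ← Real.rpow_intCast, ← Real.rpow_mul hq0.le,
    ← Real.rpow_mul hq0.le, mul_comm]

lemma tendsto_P1_atBot (hq0 : 0 < q) (hq1 : q < 1) {μ μ0 χ : ℝ} (hμ : μ = μ0 + 1 + χ) {x ξ : ℂ}
    (hx : x ≠ 0) (hξ : ξ ≠ 0) (hav : ∀ n : ℤ, x ≠ qpow q (μ0 + n) * ξ) :
    Tendsto (fun N : ℕ => P1 q μ μ0 x ((q : ℂ) ^ (-(N : ℤ)) * ξ) *
      ((q : ℂ) ^ (-(N : ℤ)) * ξ) ^ ((χ + 1 : ℝ) : ℂ)) atTop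
      (𝓝 (thetaQ q (qpow q (-μ0 - χ) * x / ξ) / thetaQ q (qpow q (-μ0 + 1) * x / ξ) *
        ξ ^ ((χ + 1 : ℝ) : ℂ))) := by
  have hp := qpow_ne_zero hq0 μ0
  have hm := qpow_ne_zero hq0 μ
  have hk := qpow_ne_zero hq0 χ
  have hq' : (q : ℂ) ≠ 0 := by exact_mod_cast hq0.ne'
  have hμ' : qpow q μ = qpow q μ0 * q * qpow q χ := by
    rw [hμ, qpow_add hq0, qpow_add hq0, qpow_one]
  have hlim := (tendsto_qPochInf_div_zpow_neg hq0 hq1 (c := qpow q μ * ξ / x)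
    (d := qpow q μ0 * ξ / x) (by positivity)
    (fun n h => one_sub_ne_zero_of_avoids hq0 hx hav n (by rw [← h]; ring))
    (by positivity)).mul_const (ξ ^ ((χ + 1 : ℝ) : ℂ))
  have e1 : (q : ℂ) / (qpow q μ * ξ / x) = qpow q (-μ0 - χ) * x / ξ := by
    rw [qpow_sub hq0, qpow_neg, hμ']
    field_simp
  have e2 : (q : ℂ) / (qpow q μ0 * ξ / x) = qpow q (-μ0 + 1) * x / ξ := by
    rw [qpow_add hq0, qpow_neg, qpow_one]
    field_simp
  have e3 : qpow q μ0 * ξ / x / (qpow q μ * ξ / x) = (qpow q (χ + 1))⁻¹ := by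
    rw [qpow_add hq0, qpow_one, hμ']
    field_simp
  rw [e1, e2, e3] at hlim
  refine hlim.congr fun N => ?_
  rw [zpow_mul_cpow hq0 hξ, zpow_neg (qpow q (χ + 1)), zpow_natCast, inv_pow, ← mul_assoc]
  simp only [P1]
  congr 4 <;> ring

end Kernel

section Boundary

variable {q : ℝ} {ξ : ℂ}

/-- The boundary term produced by summation by parts on the spiral `q^n ξ`. -/
noncomputable def boundaryTerm (q : ℝ) (ξ u1 u2 v1 v2 r B : ℂ) (H P : ℤ → ℂ) (n : ℤ) : ℂ :=
  ((q : ℂ) ^ n * ξ - u1) * ((q : ℂ) ^ n * ξ - u2) * r * H (n - 1) * P n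
    - B * ((q : ℂ) ^ (n - 1) * ξ - v1) * ((q : ℂ) ^ (n - 1) * ξ - v2) / r * H n * P (n - 1)

lemma tendsto_boundaryTerm_atTop (hq0 : 0 < q) (hq1 : q < 1) (u1 u2 v1 v2 r B : ℂ)
    {H P : ℤ → ℂ} {C : ℂ} (hH : Tendsto (fun N : ℕ => H N) atTop (𝓝 C))
    (hP : Tendsto (fun N : ℕ => P N) atTop (𝓝 1)) :
    Tendsto (fun N : ℕ => boundaryTerm q ξ u1 u2 v1 v2 r B H P N) atTop
      (𝓝 (C * (u1 * u2 * r - B * v1 * v2 / r))) := by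
  rw [← tendsto_add_atTop_iff_nat 1]
  have hs := tendsto_pow_mul_zero hq0 hq1 ξ
  have hs' := (tendsto_add_atTop_iff_nat 1).2 hs
  have hH' := (tendsto_add_atTop_iff_nat 1).2 hH
  have hP' := (tendsto_add_atTop_iff_nat 1).2 hP
  have := (((((hs'.sub_const u1).mul (hs'.sub_const u2)).mul_const r).mul hH).mul hP').sub
    ((((((hs.sub_const v1).const_mul B).mul (hs.sub_const v2)).div_const r).mul hH').mul hP)
  convert this using 1
  · funext N
    simp only [boundaryTerm, Nat.cast_add, Nat.cast_one, add_sub_cancel_right, zpow_natCast]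
    norm_cast
  · congr 1
    ring

lemma tendsto_boundaryTerm_atBot (hq0 : 0 < q) (hq1 : q < 1) (hξ : ξ ≠ 0)
    (u1 u2 v1 v2 B : ℂ) {r k : ℂ} (hk : k ≠ 0)
    {H P K φ : ℤ → ℂ} {C L : ℂ} (hH : ∀ n, H n = K n * φ n)
    (hφ : ∀ n, φ n = k / q * φ (n - 1))
    (hK : Tendsto (fun N : ℕ => K (-(N : ℤ))) atTop (𝓝 C))
    (hP : Tendsto (fun N : ℕ => P (-(N : ℤ)) * (φ (-(N : ℤ)) * ((q : ℂ) ^ (-(N : ℤ)) * ξ) ^ 2))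
      atTop (𝓝 L)) :
    Tendsto (fun N : ℕ => boundaryTerm q ξ u1 u2 v1 v2 r B H P (-(N : ℤ))) atTop
      (𝓝 (C * L * (r * q / k - B * k / (q * r)))) := by
  have hq' : (q : ℂ) ≠ 0 := by exact_mod_cast hq0.ne'
  have hinv : Tendsto (fun N : ℕ => (q : ℂ) ^ N * ξ⁻¹) atTop (𝓝 0) :=
    tendsto_pow_mul_zero hq0 hq1 ξ⁻¹
  have hK' := (tendsto_add_atTop_iff_nat 1).2 hK
  have hP' := (tendsto_add_atTop_iff_nat 1).2 hP
  have h1 : ∀ w : ℂ, Tendsto (fun N : ℕ => 1 - (q : ℂ) ^ N * ξ⁻¹ * w) atTop (𝓝 1) := fun w => by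
    simpa using (hinv.mul_const w).const_sub 1
  have h1' : ∀ w : ℂ, Tendsto (fun N : ℕ => 1 - (q : ℂ) ^ (N + 1) * ξ⁻¹ * w) atTop (𝓝 1) :=
    fun w => (tendsto_add_atTop_iff_nat 1).2 (h1 w)
  have := (((((h1 u1).mul (h1 u2)).mul_const (r * q / k)).mul hK').mul hP).sub
    (((((h1' v1).mul (h1' v2)).mul_const (B * k / (q * r))).mul hK).mul hP')
  convert this using 1
  · funext N
    have e : -(N : ℤ) - 1 = -((N + 1 : ℕ) : ℤ) := by push_cast; ring
    have hs : ∀ M : ℕ, ∀ w : ℂ, (q : ℂ) ^ (-(M : ℤ)) * ξ - w =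
        (q : ℂ) ^ (-(M : ℤ)) * ξ * (1 - (q : ℂ) ^ M * ξ⁻¹ * w) := fun M w => by
      rw [zpow_neg, zpow_natCast]
      field_simp
    have hφN := hφ (-(N : ℤ))
    rw [e] at hφN
    simp only [boundaryTerm, e, hs, hH]
    rw [hφN]
    by_cases hr : r = 0
    · simp [hr]
    field_simp
  · congr 1
    ring

lemma exists_hasBilatSum (hq0 : 0 < q) (hq1 : q < 1) (hξ : ξ ≠ 0)
    {H P K φ : ℤ → ℂ} {C1 C2 L : ℂ} (hH : ∀ n, H n = K n * φ n)
    (hH1 : Tendsto (fun N : ℕ => H N) atTop (𝓝 C1))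
    (hP1 : Tendsto (fun N : ℕ => P N) atTop (𝓝 1))
    (hK : Tendsto (fun N : ℕ => K (-(N : ℤ))) atTop (𝓝 C2))
    (hP : Tendsto (fun N : ℕ => P (-(N : ℤ)) * (φ (-(N : ℤ)) * ((q : ℂ) ^ (-(N : ℤ)) * ξ) ^ 2))
      atTop (𝓝 L)) :
    ∃ S, HasBilatSum (fun n : ℤ => (1 - (q : ℂ)) * ((q : ℂ) ^ n * ξ) * (H n * P n)) S := by
  have hq' : (q : ℂ) ≠ 0 := by exact_mod_cast hq0.ne'
  have hp := (summable_mul_pow hq0 hq1 ((hH1.mul hP1).const_mul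
    ((1 - (q : ℂ)) * ξ))).tendsto_sum_tsum_nat
  have hm := ((summable_nat_add_iff 1).2 (summable_mul_pow hq0 hq1 ((hK.mul hP).const_mul
    ((1 - (q : ℂ)) * ξ⁻¹)))).tendsto_sum_tsum_nat
  refine ⟨_, _, _, hp.congr fun N => Finset.sum_congr rfl fun n _ => ?_,
    hm.congr fun N => Finset.sum_congr rfl fun n _ => ?_, rfl⟩
  · beta_reduce
    rw [zpow_natCast]
    ring
  · have e : -(n : ℤ) - 1 = -((n + 1 : ℕ) : ℤ) := by push_cast; ring
    beta_reduce
    rw [e, hH, zpow_neg, zpow_natCast]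
    field_simp

end Boundary

/-- Summation by parts for a three-term recurrence on the spiral, combined with the kernel
identity. -/
lemma telescope_identity {q : ℝ} {ξ p k A A1 A2 x E : ℂ} (u1 u2 v1 v2 : ℂ) {H P : ℤ → ℂ} {X : ℂ}
    (n : ℤ) (hq : (q : ℂ) ≠ 0) (hk : k ≠ 0) (hA1 : A1 ≠ 0) (hx : x ≠ 0) (hξ : ξ ≠ 0)
    (hne : 1 - p * ((q : ℂ) ^ n * ξ) / x / q ≠ 0)
    (h0 : P n = (1 - p * q * k * ((q : ℂ) ^ n * ξ) / x) * X)
    (hp : P (n + 1) = (1 - p * ((q : ℂ) ^ n * ξ) / x) * X)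
    (hm : P (n - 1) * (1 - p * ((q : ℂ) ^ n * ξ) / x / q) =
      (1 - p * k * ((q : ℂ) ^ n * ξ) / x) * P n)
    (heig : ((q : ℂ) ^ n * ξ)⁻¹ * ((q : ℂ) ^ n * ξ - u1) * ((q : ℂ) ^ n * ξ - u2) *
          (A1 * k / q * H (n - 1))
        + A1 * A2 * ((q : ℂ) ^ n * ξ)⁻¹ * ((q : ℂ) ^ n * ξ - v1) * ((q : ℂ) ^ n * ξ - v2) *
          (H (n + 1) / (A1 * k / q))
        - ((A1 + A2) * ((q : ℂ) ^ n * ξ) + (q * v1 * v2 * A2 / k + u1 * u2 / q * A1 * k) *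
          ((q : ℂ) ^ n * ξ)⁻¹) * H n = E * H n) :
    (q : ℂ) ^ n * ξ * H n * (A * (x⁻¹ * (x - p * k * u1) * (x - p * k * u2)) * P (n + 1)
      + A * A2 / (A1 * k) * (x⁻¹ * (x - p * v1) * (x - p * v2)) * P (n - 1)
      - ((A + A * A2 / (A1 * k)) * x
        + (q * v1 * v2 * p ^ 2 * A * A2 / A1 + u1 * u2 / q * k * p ^ 2 * A) * x⁻¹) * P n
      - p * A / A1 * E * P n)
    = p * A / A1 * (boundaryTerm q ξ u1 u2 v1 v2 (A1 * k / q) (A1 * A2) H P (n + 1)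
      - boundaryTerm q ξ u1 u2 v1 v2 (A1 * k / q) (A1 * A2) H P n) := by
  have hs : (q : ℂ) ^ n * ξ ≠ 0 := mul_ne_zero (zpow_ne_zero _ hq) hξ
  have key := kernel_identity (A := A) (A2 := A2) u1 u2 v1 v2 hq hk hA1 hx hs hne h0 hp hm
  rw [key]
  simp only [boundaryTerm, add_sub_cancel_right, zpow_add_one₀ hq, zpow_sub_one₀ hq]
  generalize hS : (q : ℂ) ^ n = S at *
  have hS0 : S ≠ 0 := left_ne_zero_of_mul hs
  linear_combination (norm := (field_simp; ring)) (p * A / A1 * (S * ξ * P n)) * heig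

theorem stmt11 (q : ℝ) (hq0 : 0 < q) (hq1 : q < 1)
    (h1' h2' l1' l2' a1' a2' b' μ0 a1 : ℝ) (t1 t2 ξ : ℂ)
    (ht1 : t1 ≠ 0) (ht2 : t2 ≠ 0) (hξ : ξ ≠ 0) (E' C1 C2 : ℂ)
    (lam χ μ b a2 l1 l2 h1 h2 : ℝ) (E : ℂ)
    (hlam : lam = (h1' + h2' - l1' - l2' - a1' - a2' + b' + 2) / 2)
    (hχ : χ = (l1' + l2' - h1' - h2' - a1' + a2' - b') / 2)
    (hμ : μ = μ0 + 1 + χ)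
    (hE : E = qpow q (μ0 + a1 - a1') * E')
    (hb : b = -b' - χ)
    (ha2 : a2 = a1 - a1' + a2' - χ)
    (hl1 : l1 = l1' + μ0) (hl2 : l2 = l2' + μ0)
    (hh1 : h1 = h1' + μ0 + χ) (hh2 : h2 = h2' + μ0 + χ)
    (h : ℂ → ℂ)
    (heig : ∀ n : ℤ, A4 q t1 t2 h1' h2' l1' l2' a1' a2' b' h ((q : ℂ) ^ n * ξ)
      = E' * h ((q : ℂ) ^ n * ξ))
    (hC1 : Filter.Tendsto
      (fun L : ℤ => h ((q : ℂ) ^ L * ξ) / ((q : ℂ) ^ L * ξ) ^ ((lam : ℝ) : ℂ))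
      Filter.atTop (nhds C1))
    (hC2 : Filter.Tendsto
      (fun K : ℤ => h ((q : ℂ) ^ K * ξ) / ((q : ℂ) ^ K * ξ) ^ ((-a1' : ℝ) : ℂ))
      Filter.atBot (nhds C2)) :
    ∃ J : ℂ → ℂ,
      (∀ y : ℂ, y ≠ 0 → (∀ n : ℤ, y ≠ qpow q (μ0 + n) * ξ) →
        HasBilatSum (fun n : ℤ =>
          (1 - (q : ℂ)) * ((q : ℂ) ^ n * ξ) *
            (((q : ℂ) ^ n * ξ) ^ ((-lam : ℝ) : ℂ) * h ((q : ℂ) ^ n * ξ) *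
              P1 q μ μ0 y ((q : ℂ) ^ n * ξ))) (J y)) ∧
      (∀ x : ℂ, x ≠ 0 → (∀ n : ℤ, x ≠ qpow q (μ0 + n) * ξ) →
        A4 q t1 t2 h1 h2 l1 l2 a1 a2 b (fun y => y ^ ((-a1 : ℝ) : ℂ) * J y) x
          = E * (x ^ ((-a1 : ℝ) : ℂ) * J x)
            + (1 - (q : ℂ)) *
              (C2 * x ^ ((-a1 : ℝ) : ℂ) *
                  (thetaQ q (qpow q (-μ0 - χ) * x / ξ) / thetaQ q (qpow q (-μ0 + 1) * x / ξ)) *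
                  ξ ^ ((χ + 1 : ℝ) : ℂ) * qpow q (μ0 + a1) * (qpow q (a2' - a1') - 1)
                - C1 * x ^ ((-a1 : ℝ) : ℂ) * qpow q (μ0 + a1 + h1' + h2' + χ) *
                  (qpow q b' - 1) * t1 * t2)) := by
  have hq : (q : ℂ) ≠ 0 := by exact_mod_cast hq0.ne'
  have hs : ∀ n : ℤ, (q : ℂ) ^ n * ξ ≠ 0 := fun n => mul_ne_zero (zpow_ne_zero _ hq) hξ
  set H : ℤ → ℂ := fun n => ((q : ℂ) ^ n * ξ) ^ ((-lam : ℝ) : ℂ) * h ((q : ℂ) ^ n * ξ) with hHdef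
  set K : ℤ → ℂ := fun n => h ((q : ℂ) ^ n * ξ) / ((q : ℂ) ^ n * ξ) ^ ((-a1' : ℝ) : ℂ) with hKdef
  set φ : ℤ → ℂ := fun n => ((q : ℂ) ^ n * ξ) ^ ((χ - 1 : ℝ) : ℂ) with hφdef
  have hp := qpow_ne_zero hq0 μ0
  have hk := qpow_ne_zero hq0 χ
  have hA := qpow_ne_zero hq0 a1
  have hA1 := qpow_ne_zero hq0 a1'
  set u1 := qpow q (h1' + 1 / 2) * t1 with hu1
  set u2 := qpow q (h2' + 1 / 2) * t2 with hu2
  set v1 := qpow q (l1' - 1 / 2) * t1 with hv1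
  set v2 := qpow q (l2' - 1 / 2) * t2 with hv2
  have hsucc : ∀ n : ℤ, (q : ℂ) * ((q : ℂ) ^ n * ξ) = (q : ℂ) ^ (n + 1) * ξ := fun n => by
    rw [zpow_add_one₀ hq]; ring
  have hpred : ∀ n : ℤ, (q : ℂ) ^ n * ξ / q = (q : ℂ) ^ (n - 1) * ξ := fun n => by
    rw [zpow_sub_one₀ hq]; ring
  have hrl : qpow q (-lam) = qpow q a1' * qpow q χ / q := by
    rw [show -lam = a1' + χ - 1 by rw [hlam, hχ]; ring, qpow_sub hq0, qpow_add hq0, qpow_one]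
  have hHK : ∀ n, H n = K n * φ n := fun n => by
    have e : ((q : ℂ) ^ n * ξ) ^ ((-lam : ℝ) : ℂ) =
        (((q : ℂ) ^ n * ξ) ^ ((-a1' : ℝ) : ℂ))⁻¹ * ((q : ℂ) ^ n * ξ) ^ ((χ - 1 : ℝ) : ℂ) := by
      rw [← Complex.cpow_neg, ← Complex.cpow_add _ _ (hs n), hlam, hχ]
      congr 1
      push_cast
      ring
    simp only [hHdef, hKdef, hφdef]
    rw [e]
    ring
  have hφ : ∀ n, φ n = qpow q χ / q * φ (n - 1) := fun n => by
    simp only [hφdef]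
    have := ofReal_mul_cpow hq0 (hs (n - 1)) (χ - 1)
    rw [hsucc, sub_add_cancel, qpow_sub hq0, qpow_one] at this
    exact this
  have hφs : ∀ n : ℤ, φ n * ((q : ℂ) ^ n * ξ) ^ 2 = ((q : ℂ) ^ n * ξ) ^ ((χ + 1 : ℝ) : ℂ) :=
    fun n => by
      simp only [hφdef]
      rw [← Complex.cpow_two, ← Complex.cpow_add _ _ (hs n)]
      congr 1
      push_cast
      ring
  have hH1 : Tendsto (fun N : ℕ => H N) atTop (𝓝 C1) := by
    refine (hC1.comp tendsto_natCast_atTop_atTop).congr fun N => ?_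
    simp only [hHdef, Function.comp_apply]
    rw [Complex.ofReal_neg, Complex.cpow_neg]
    ring
  have hK : Tendsto (fun N : ℕ => K (-(N : ℤ))) atTop (𝓝 C2) :=
    hC2.comp (tendsto_neg_atTop_atBot.comp tendsto_natCast_atTop_atTop)
  have hPbot : ∀ y : ℂ, y ≠ 0 → (∀ n : ℤ, y ≠ qpow q (μ0 + n) * ξ) →
      Tendsto (fun N : ℕ => P1 q μ μ0 y ((q : ℂ) ^ (-(N : ℤ)) * ξ) *
        (φ (-(N : ℤ)) * ((q : ℂ) ^ (-(N : ℤ)) * ξ) ^ 2)) atTop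
      (𝓝 (thetaQ q (qpow q (-μ0 - χ) * y / ξ) / thetaQ q (qpow q (-μ0 + 1) * y / ξ) *
        ξ ^ ((χ + 1 : ℝ) : ℂ))) := fun y hy hav => by
    simp only [hφs]
    exact tendsto_P1_atBot hq0 hq1 hμ hy hξ hav
  have hconv : ∀ y : ℂ, ∃ S : ℂ, y ≠ 0 → (∀ n : ℤ, y ≠ qpow q (μ0 + n) * ξ) →
      HasBilatSum (fun n : ℤ => (1 - (q : ℂ)) * ((q : ℂ) ^ n * ξ) *
        (H n * P1 q μ μ0 y ((q : ℂ) ^ n * ξ))) S := fun y => by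
    by_cases hy : y ≠ 0 ∧ ∀ n : ℤ, y ≠ qpow q (μ0 + n) * ξ
    · obtain ⟨S, hS⟩ := exists_hasBilatSum hq0 hq1 hξ
        (P := fun n => P1 q μ μ0 y ((q : ℂ) ^ n * ξ)) hHK hH1
        (tendsto_P1_atTop hq0 hq1 μ μ0 y ξ) hK (hPbot y hy.1 hy.2)
      exact ⟨S, fun _ _ => hS⟩
    · exact ⟨0, fun h1 h2 => absurd ⟨h1, h2⟩ hy⟩
  choose J hJ using hconv
  refine ⟨J, hJ, fun x hx hav => ?_⟩
  have hcs : qpow q ((h1' + h2' + l1' + l2' + a1' + a2') / 2) *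
      (qpow q (b' / 2) + qpow q (-(b' / 2))) * t1 * t2 =
      q * v1 * v2 * qpow q a2' / qpow q χ + u1 * u2 / q * qpow q a1' * qpow q χ := by
    rw [mul_add, ← qpow_add hq0, ← qpow_add hq0,
      show (h1' + h2' + l1' + l2' + a1' + a2') / 2 + b' / 2 =
        1 + (l1' - 1 / 2) + (l2' - 1 / 2) + a2' - χ by rw [hχ]; ring,
      show (h1' + h2' + l1' + l2' + a1' + a2') / 2 + -(b' / 2) =
        (h1' + 1 / 2) + (h2' + 1 / 2) - 1 + a1' + χ by rw [hχ]; ring]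
    rw [qpow_sub hq0 _ χ, qpow_add hq0 _ χ, qpow_add hq0 _ a1', qpow_add hq0 _ a2',
      qpow_sub hq0 _ 1, qpow_add hq0 _ (l2' - 1 / 2), qpow_add hq0 1, qpow_one,
      qpow_add hq0 (h1' + 1 / 2), hu1, hu2, hv1, hv2]
    ring
  have ha2q : qpow q a2 = qpow q a1 * qpow q a2' / (qpow q a1' * qpow q χ) := by
    rw [ha2, qpow_sub hq0, qpow_add hq0, qpow_sub hq0]
    field_simp
  have hcx : qpow q ((h1 + h2 + l1 + l2 + a1 + a2) / 2) *
      (qpow q (b / 2) + qpow q (-(b / 2))) * t1 * t2 =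
      q * v1 * v2 * qpow q μ0 ^ 2 * qpow q a1 * qpow q a2' / qpow q a1'
        + u1 * u2 / q * qpow q χ * qpow q μ0 ^ 2 * qpow q a1 := by
    rw [mul_add, ← qpow_add hq0, ← qpow_add hq0,
      show (h1 + h2 + l1 + l2 + a1 + a2) / 2 + -(b / 2) =
        1 + (l1' - 1 / 2) + (l2' - 1 / 2) + μ0 + μ0 + a1 + a2' - a1' by
          rw [hh1, hh2, hl1, hl2, ha2, hb, hχ]; ring,
      show (h1 + h2 + l1 + l2 + a1 + a2) / 2 + b / 2 =
        (h1' + 1 / 2) + (h2' + 1 / 2) - 1 + χ + μ0 + μ0 + a1 by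
          rw [hh1, hh2, hl1, hl2, ha2, hb, hχ]; ring]
    rw [qpow_sub hq0 _ a1', qpow_add hq0 _ a2', qpow_add hq0 _ a1, qpow_add hq0 _ a1,
      qpow_add hq0 _ μ0, qpow_add hq0 _ μ0, qpow_add hq0 _ μ0, qpow_add hq0 _ μ0,
      qpow_add hq0 _ χ, qpow_sub hq0 _ 1, qpow_add hq0 _ (l2' - 1 / 2), qpow_add hq0 1, qpow_one,
      qpow_add hq0 (h1' + 1 / 2), hu1, hu2, hv1, hv2]
    ring
  have hrec : ∀ n : ℤ, ((q : ℂ) ^ n * ξ)⁻¹ * ((q : ℂ) ^ n * ξ - u1) * ((q : ℂ) ^ n * ξ - u2) *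
          (qpow q a1' * qpow q χ / q * H (n - 1))
        + qpow q a1' * qpow q a2' * ((q : ℂ) ^ n * ξ)⁻¹ * ((q : ℂ) ^ n * ξ - v1) *
          ((q : ℂ) ^ n * ξ - v2) * (H (n + 1) / (qpow q a1' * qpow q χ / q))
        - ((qpow q a1' + qpow q a2') * ((q : ℂ) ^ n * ξ) +
          (q * v1 * v2 * qpow q a2' / qpow q χ + u1 * u2 / q * qpow q a1' * qpow q χ) *
          ((q : ℂ) ^ n * ξ)⁻¹) * H n = E' * H n := fun n => by
    have e1 : qpow q a1' * qpow q χ / q * H (n - 1) =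
        ((q : ℂ) ^ n * ξ) ^ ((-lam : ℝ) : ℂ) * h ((q : ℂ) ^ (n - 1) * ξ) := by
      have := ofReal_mul_cpow hq0 (hs (n - 1)) (-lam)
      rw [hsucc, sub_add_cancel, hrl] at this
      rw [this]
      simp only [hHdef]
      ring
    have e2 : H (n + 1) / (qpow q a1' * qpow q χ / q) =
        ((q : ℂ) ^ n * ξ) ^ ((-lam : ℝ) : ℂ) * h ((q : ℂ) ^ (n + 1) * ξ) := by
      have := ofReal_mul_cpow hq0 (hs n) (-lam)
      rw [hsucc, hrl] at this
      simp only [hHdef]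
      rw [this]
      field_simp
    have := heig n
    rw [A4, hcs, hsucc, hpred, qpow_add hq0 a1' a2'] at this
    rw [e1, e2]
    simp only [hHdef]
    linear_combination ((q : ℂ) ^ n * ξ) ^ ((-lam : ℝ) : ℂ) * this
  set P : ℤ → ℂ := fun n => P1 q μ μ0 x ((q : ℂ) ^ n * ξ) with hPdef
  have hμ' : qpow q μ = qpow q μ0 * q * qpow q χ := by
    rw [hμ, qpow_add hq0, qpow_add hq0, qpow_one]
  set G := boundaryTerm q ξ u1 u2 v1 v2 (qpow q a1' * qpow q χ / q) (qpow q a1' * qpow q a2') H P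
    with hG
  have hpt : ∀ n : ℤ, (q : ℂ) ^ n * ξ * H n * (qpow q a1 *
        (x⁻¹ * (x - qpow q μ0 * qpow q χ * u1) * (x - qpow q μ0 * qpow q χ * u2)) * P (n + 1)
      + qpow q a1 * qpow q a2' / (qpow q a1' * qpow q χ) *
        (x⁻¹ * (x - qpow q μ0 * v1) * (x - qpow q μ0 * v2)) * P (n - 1)
      - ((qpow q a1 + qpow q a1 * qpow q a2' / (qpow q a1' * qpow q χ)) * x
        + (q * v1 * v2 * qpow q μ0 ^ 2 * qpow q a1 * qpow q a2' / qpow q a1'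
          + u1 * u2 / q * qpow q χ * qpow q μ0 ^ 2 * qpow q a1) * x⁻¹) * P n
      - qpow q μ0 * qpow q a1 / qpow q a1' * E' * P n)
      = qpow q μ0 * qpow q a1 / qpow q a1' * (G (n + 1) - G n) := fun n => by
    have hne := one_sub_ne_zero_of_avoids hq0 hx hav
    obtain ⟨X, h0, h1⟩ := exists_P1_factor hq0 hq1 μ μ0 (hne n)
    have hm := P1_q_mul hq0 hq1 μ μ0 (hne (n - 1))
    rw [hμ'] at h0
    rw [hsucc] at h1
    rw [hsucc, sub_add_cancel, hμ'] at hm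
    refine telescope_identity (X := X) u1 u2 v1 v2 n hq hk hA1 hx hξ ?_ h0 h1 ?_ (hrec n)
    · have := hne (n - 1)
      rw [← hpred] at this
      convert this using 1
      ring
    · rw [← hpred] at hm
      simp only [hPdef, ← hpred]
      rw [show qpow q μ0 * ((q : ℂ) ^ n * ξ) / x / q = qpow q μ0 * ((q : ℂ) ^ n * ξ / q) / x by ring,
        ← hm]
      field_simp
  have hJ0 := (hJ x hx hav).tendsto
  have hJd := (hJ (x / q) (div_ne_zero hx hq) (avoids_div hq0 hav)).tendsto
  have hJm := (hJ (q * x) (mul_ne_zero hq hx) (avoids_mul hq0 hav)).tendsto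
  simp only [P1_div_q, P1_mul_q, hsucc, hpred] at hJd hJm
  have hlhs := (((hJd.const_mul (qpow q a1 *
      (x⁻¹ * (x - qpow q μ0 * qpow q χ * u1) * (x - qpow q μ0 * qpow q χ * u2)))).add
    (hJm.const_mul (qpow q a1 * qpow q a2' / (qpow q a1' * qpow q χ) *
        (x⁻¹ * (x - qpow q μ0 * v1) * (x - qpow q μ0 * v2))))).sub
    (hJ0.const_mul ((qpow q a1 + qpow q a1 * qpow q a2' / (qpow q a1' * qpow q χ)) * x
        + (q * v1 * v2 * qpow q μ0 ^ 2 * qpow q a1 * qpow q a2' / qpow q a1'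
          + u1 * u2 / q * qpow q χ * qpow q μ0 ^ 2 * qpow q a1) * x⁻¹))).sub
    (hJ0.const_mul (qpow q μ0 * qpow q a1 / qpow q a1' * E'))
  have hPtop : Tendsto (fun N : ℕ => P N) atTop (𝓝 1) := tendsto_P1_atTop hq0 hq1 μ μ0 x ξ
  have hGtop : Tendsto (fun N : ℕ => G N) atTop _ :=
    tendsto_boundaryTerm_atTop hq0 hq1 u1 u2 v1 v2 _ _ hH1 hPtop
  have hGbot : Tendsto (fun N : ℕ => G (-(N : ℤ))) atTop _ :=
    tendsto_boundaryTerm_atBot (P := P) hq0 hq1 hξ u1 u2 v1 v2 _ hk hHK hφ hK (hPbot x hx hav)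
  have hrhs := (hGtop.sub hGbot).const_mul
    ((1 - (q : ℂ)) * (qpow q μ0 * qpow q a1 / qpow q a1'))
  have hlim := tendsto_nhds_unique (hlhs.congr fun N => ?_) hrhs
  · have hb' : qpow q a1' * qpow q a2' * v1 * v2 / (qpow q a1' * qpow q χ / q) =
        u1 * u2 * (qpow q a1' * qpow q χ / q) * qpow q b' := by
      have e : qpow q a1' * qpow q a2' * qpow q (l1' - 1 / 2) * qpow q (l2' - 1 / 2) /
            (qpow q a1' * qpow q χ / qpow q 1) =
          qpow q (h1' + 1 / 2) * qpow q (h2' + 1 / 2) * (qpow q a1' * qpow q χ / qpow q 1) *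
            qpow q b' := by
        simp only [← qpow_add hq0, ← qpow_sub hq0]
        congr 1
        rw [hχ]
        ring
      rw [qpow_one] at e
      rw [hu1, hu2, hv1, hv2]
      linear_combination t1 * t2 * e
    have huu : u1 * u2 = qpow q h1' * qpow q h2' * q * t1 * t2 := by
      have e : qpow q (h1' + 1 / 2) * qpow q (h2' + 1 / 2) =
          qpow q h1' * qpow q h2' * qpow q 1 := by
        simp only [← qpow_add hq0]
        congr 1
        ring
      rw [qpow_one] at e
      rw [hu1, hu2]
      linear_combination t1 * t2 * e
    rw [hb', huu] at hlim
    have hU1 : qpow q (h1 + 1 / 2) * t1 = qpow q μ0 * qpow q χ * u1 := by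
      rw [hh1, show h1' + μ0 + χ + 1 / 2 = μ0 + χ + (h1' + 1 / 2) by ring, qpow_add hq0,
        qpow_add hq0 μ0, hu1]
      ring
    have hU2 : qpow q (h2 + 1 / 2) * t2 = qpow q μ0 * qpow q χ * u2 := by
      rw [hh2, show h2' + μ0 + χ + 1 / 2 = μ0 + χ + (h2' + 1 / 2) by ring, qpow_add hq0,
        qpow_add hq0 μ0, hu2]
      ring
    have hV1 : qpow q (l1 - 1 / 2) * t1 = qpow q μ0 * v1 := by
      rw [hl1, show l1' + μ0 - 1 / 2 = μ0 + (l1' - 1 / 2) by ring, qpow_add hq0, hv1]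
      ring
    have hV2 : qpow q (l2 - 1 / 2) * t2 = qpow q μ0 * v2 := by
      rw [hl2, show l2' + μ0 - 1 / 2 = μ0 + (l2' - 1 / 2) by ring, qpow_add hq0, hv2]
      ring
    have hκ : qpow q (μ0 + a1 - a1') = qpow q μ0 * qpow q a1 / qpow q a1' := by
      rw [qpow_sub hq0, qpow_add hq0]
    have hg1 : qpow q (μ0 + a1 + h1' + h2' + χ) =
        qpow q μ0 * qpow q a1 * qpow q h1' * qpow q h2' * qpow q χ := by
      simp only [qpow_add hq0]
    rw [A4, hcx, huu, hU1, hU2, hV1, hV2, div_ofReal_cpow hq0 hx, ofReal_mul_cpow hq0 hx,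
      qpow_neg q a1, qpow_add hq0 a1 a2, ha2q, hE, hκ, hg1, qpow_add hq0 μ0 a1,
      qpow_sub hq0 a2' a1']
    generalize thetaQ q (qpow q (-μ0 - χ) * x / ξ) / thetaQ q (qpow q (-μ0 + 1) * x / ξ) = Θ
      at hlim ⊢
    linear_combination (norm := (field_simp; ring)) x ^ ((-a1 : ℝ) : ℂ) * hlim
  · rw [Finset.mul_sum, Finset.mul_sum, Finset.mul_sum, Finset.mul_sum, ← Finset.sum_add_distrib,
      ← Finset.sum_sub_distrib, ← Finset.sum_sub_distrib, ← sum_bilat_telescope G N,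
      Finset.mul_sum]
    refine Finset.sum_congr rfl fun n _ => ?_
    have hn := hpt n
    have hn' := hpt (-(n : ℤ) - 1)
    simp only [hPdef] at hn hn'
    linear_combination (1 - (q : ℂ)) * hn + (1 - (q : ℂ)) * hn'
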